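/- Let (a_n)_{n≥0} be a sequence of integers with a_n ≥ 4 for all n. Then the set C_0 = Θ({−1,0,1}^ℕ) ⊆ ℝ is compact, has no isolated points, and is totally disconnected; that is, C_0 is a Cantor set. -/

import Mathlib

/-- `Theta a ε = ∑_{n≥0} ε_n / (a_0 a_1 ⋯ a_{n+1})`. -/
noncomputable def Theta (a : ℕ → ℤ) (ε : ℕ → ℤ) : ℝ :=
  ∑' n : ℕ, (ε n : ℝ) / ∏ j ∈ Finset.range (n + 2), (a j : ℝ)

/-- `Θ` viewed as a map on the space `{-1,0,1}^ℕ` with the product topology. -/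
noncomputable def ThetaMap (a : ℕ → ℤ) (ε : ℕ → ({-1, 0, 1} : Set ℤ)) : ℝ :=
  Theta a fun n => (ε n : ℤ)

/-- The partial products of `a` are positive and grow at least geometrically with ratio `4`. -/
lemma pow_mul_prod_le_prod {a : ℕ → ℤ} (ha : ∀ n, 4 ≤ a n) (m k : ℕ) :
    0 < ∏ j ∈ Finset.range m, (a j : ℝ) ∧
      4 ^ k * ∏ j ∈ Finset.range m, (a j : ℝ) ≤ ∏ j ∈ Finset.range (m + k), (a j : ℝ) := by
  have h4 : ∀ n, (4 : ℝ) ≤ a n := fun n => by exact_mod_cast ha n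
  have hpos : ∀ m, 0 < ∏ j ∈ Finset.range m, (a j : ℝ) := fun m =>
    Finset.prod_pos fun j _ => by linarith [h4 j]
  refine ⟨hpos m, ?_⟩
  induction k with
  | zero => simp
  | succ k ih =>
    rw [← add_assoc, Finset.prod_range_succ, pow_succ]
    nlinarith [h4 (m + k), hpos (m + k)]

/-- Terms of the tail of a `Theta` series are dominated by a geometric sequence. -/
lemma abs_div_prod_le {a : ℕ → ℤ} (ha : ∀ n, 4 ≤ a n) {c : ℝ} (hc : 0 ≤ c) {x : ℝ}
    (hx : |x| ≤ c) (m k : ℕ) :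
    |x / ∏ j ∈ Finset.range (m + k), (a j : ℝ)| ≤
      c / (∏ j ∈ Finset.range m, (a j : ℝ)) * (1 / 4) ^ k := by
  obtain ⟨h0, h1⟩ := pow_mul_prod_le_prod ha m k
  obtain ⟨h2, -⟩ := pow_mul_prod_le_prod ha (m + k) 0
  rw [abs_div, abs_of_pos h2, one_div, inv_pow, ← div_eq_mul_inv, div_div]
  exact div_le_div₀ hc hx (by positivity) (by rwa [mul_comm])

lemma abs_digit_le_one (e : ({-1, 0, 1} : Set ℤ)) : |((e : ℤ) : ℝ)| ≤ 1 := by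
  obtain ⟨e, rfl | rfl | rfl⟩ := e <;> simp

lemma abs_theta_term_le {a : ℕ → ℤ} (ha : ∀ n, 4 ≤ a n) (e : ({-1, 0, 1} : Set ℤ)) (n : ℕ) :
    |((e : ℤ) : ℝ) / ∏ j ∈ Finset.range (n + 2), (a j : ℝ)| ≤
      1 / (∏ j ∈ Finset.range 2, (a j : ℝ)) * (1 / 4) ^ n := by
  rw [add_comm n 2]
  exact abs_div_prod_le ha zero_le_one (abs_digit_le_one e) 2 n

lemma summable_const_mul_quarter_pow (c : ℝ) : Summable fun n : ℕ => c * (1 / 4 : ℝ) ^ n :=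
  (summable_geometric_of_lt_one (by norm_num) (by norm_num)).mul_left c

lemma summable_theta {a : ℕ → ℤ} (ha : ∀ n, 4 ≤ a n) (ε : ℕ → ({-1, 0, 1} : Set ℤ)) :
    Summable fun n => ((ε n : ℤ) : ℝ) / ∏ j ∈ Finset.range (n + 2), (a j : ℝ) :=
  .of_norm_bounded (summable_const_mul_quarter_pow _) fun n => abs_theta_term_le ha (ε n) n

lemma continuous_thetaMap {a : ℕ → ℤ} (ha : ∀ n, 4 ≤ a n) : Continuous (ThetaMap a) := by
  refine continuous_tsum (fun n => ?_) (summable_const_mul_quarter_pow _)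
    fun n ε => abs_theta_term_le ha (ε n) n
  have hc : Continuous fun e : ({-1, 0, 1} : Set ℤ) => ((e : ℤ) : ℝ) :=
    continuous_of_discreteTopology
  exact (hc.comp (continuous_apply n)).div_const _

lemma injective_thetaMap {a : ℕ → ℤ} (ha : ∀ n, 4 ≤ a n) : Function.Injective (ThetaMap a) := by
  classical
  intro ε δ h
  by_contra hne
  have hex : ∃ n, ε n ≠ δ n := Function.ne_iff.mp hne
  obtain ⟨N, hN, hmin⟩ : ∃ N, ε N ≠ δ N ∧ ∀ n < N, ε n = δ n :=
    ⟨Nat.find hex, Nat.find_spec hex, fun n hn => not_not.mp (Nat.find_min hex hn)⟩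
  set d : ℕ → ℝ := fun n => ((ε n : ℤ) : ℝ) - ((δ n : ℤ) : ℝ) with hd
  set P : ℕ → ℝ := fun n => ∏ j ∈ Finset.range n, (a j : ℝ) with hP
  have hsum : Summable fun n => d n / P (n + 2) := by
    simpa only [hd, hP, sub_div] using (summable_theta ha ε).sub (summable_theta ha δ)
  have hzero : ∑' n, d n / P (n + 2) = 0 := by
    simp only [hd, hP, sub_div]
    rw [(summable_theta ha ε).tsum_sub (summable_theta ha δ)]
    exact sub_eq_zero.mpr h
  have hhead : ∑ n ∈ Finset.range (N + 1), d n / P (n + 2) = d N / P (N + 2) := by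
    rw [Finset.sum_range_succ, Finset.sum_eq_zero, zero_add]
    intro n hn
    simp [hd, hmin n (Finset.mem_range.mp hn)]
  have hsplit := hsum.sum_add_tsum_nat_add (N + 1)
  rw [hzero, hhead] at hsplit
  have hPpos : 0 < P (N + 2) := (pow_mul_prod_le_prod ha (N + 2) 0).1
  have hd2 : ∀ n, |d n| ≤ 2 := fun n =>
    (abs_sub _ _).trans (by linarith [abs_digit_le_one (ε n), abs_digit_le_one (δ n)])
  have htail : |∑' k, d (k + (N + 1)) / P (k + (N + 1) + 2)| ≤ 2 / 3 / P (N + 2) := by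
    have hgeom : HasSum (fun k : ℕ => 2 / P (N + 2) * (1 / 4 : ℝ) ^ (k + 1))
        (2 / 3 / P (N + 2)) := by
      have hg := (hasSum_geometric_of_lt_one (r := (1 / 4 : ℝ)) (by norm_num)
        (by norm_num)).mul_left (2 / P (N + 2) * (1 / 4))
      rw [show 2 / P (N + 2) * (1 / 4) * (1 - 1 / 4 : ℝ)⁻¹ = 2 / 3 / P (N + 2) by
        rw [show (1 - 1 / 4 : ℝ)⁻¹ = 4 / 3 by norm_num]; ring] at hg
      simpa only [pow_succ', mul_assoc] using hg
    rw [← Real.norm_eq_abs]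
    refine tsum_of_norm_bounded hgeom fun k => ?_
    have := abs_div_prod_le ha zero_le_two (hd2 (k + (N + 1))) (N + 2) (k + 1)
    rwa [show N + 2 + (k + 1) = k + (N + 1) + 2 by ring] at this
  have hd1 : 1 ≤ |d N| := by
    have hz : (ε N : ℤ) - δ N ≠ 0 := sub_ne_zero.mpr fun h => hN (Subtype.ext h)
    have := Int.one_le_abs hz
    simp only [hd]
    exact_mod_cast this
  have hlead : 1 / P (N + 2) ≤ |d N / P (N + 2)| := by
    rw [abs_div, abs_of_pos hPpos]
    gcongr
  rw [← neg_eq_of_add_eq_zero_right hsplit, abs_neg] at htail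
  have := hlead.trans htail
  rw [div_le_div_iff_of_pos_right hPpos] at this
  norm_num at this

/-- A continuous injective image of a countable power of a nontrivial space has no isolated
points. -/
lemma preperfect_range_of_injective {X Y : Type*} [TopologicalSpace X] [Nontrivial X]
    [TopologicalSpace Y] {f : (ℕ → X) → Y} (hf : Continuous f) (hinj : Function.Injective f) :
    Preperfect (Set.range f) := by
  classical
  rw [preperfect_iff_nhds]
  rintro _ ⟨x, rfl⟩ U hU
  choose c hc using fun n => exists_ne (x n)
  have hlim : Filter.Tendsto (fun n => Function.update x n (c n)) Filter.atTop (nhds x) := by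
    refine tendsto_pi_nhds.mpr fun i => tendsto_const_nhds.congr' ?_
    filter_upwards [Filter.eventually_gt_atTop i] with n hn
    rw [Function.update_of_ne hn.ne]
  obtain ⟨n, hn⟩ := ((hf.tendsto x).comp hlim |>.eventually hU).exists
  refine ⟨_, ⟨hn, Set.mem_range_self _⟩, fun h => hc n ?_⟩
  simpa using congrFun (hinj h) n

/-- If `a_n ≥ 4` for all `n`, then `C₀ = Θ({-1,0,1}^ℕ) ⊆ ℝ` is compact,
has no isolated points (every point is an accumulation point of `C₀`), and is totally
disconnected; i.e. `C₀` is a Cantor set. -/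
theorem stmt5 (a : ℕ → ℤ) (ha : ∀ n, 4 ≤ a n) :
    IsCompact (Set.range (ThetaMap a)) ∧
      Preperfect (Set.range (ThetaMap a)) ∧
        IsTotallyDisconnected (Set.range (ThetaMap a)) := by
  have hc := continuous_thetaMap ha
  have hi := injective_thetaMap ha
  have : Nontrivial ({-1, 0, 1} : Set ℤ) := ⟨⟨0, by simp⟩, ⟨1, by simp⟩, by simp⟩
  exact ⟨isCompact_range hc, preperfect_range_of_injective hc hi,
    (hc.isClosedEmbedding hi).isEmbedding.isTotallyDisconnected_range.mpr inferInstance⟩
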